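/- arXiv:1610.02837 — 3 statements merged into one kernel-verified Lean document; each statement's English description precedes it below -/
import Mathlib

section
/- Let E be a finite-dimensional vector space over ℚ, let σ ⊆ E be the convex cone generated by a finite set of vectors, let P ⊆ E be the convex hull of a finite nonempty set (a polytope), set C = P + σ (Minkowski sum), and let m : E → ℚ be a linear functional with m(v) ≥ 0 for all v in σ. Then m attains its minimum on C, and the face face(C, m) = {v ∈ C : m(v) ≤ m(v') for all v' ∈ C} is again of the form Q + (σ ∩ m^{-1}(0)) for some polytope Q; that is, face(C, m) is a (σ ∩ m^⊥)-polyhedron. -/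
open Pointwise

/-- A linear functional bounded below on a set is bounded below on its convex hull. -/
theorem LinearMap.le_of_mem_convexHull {E : Type*} [AddCommGroup E] [Module ℚ E]
    {s : Set E} (m : E →ₗ[ℚ] ℚ) {μ : ℚ} (h : ∀ x ∈ s, μ ≤ m x) {a : E}
    (ha : a ∈ convexHull ℚ s) : μ ≤ m a :=
  convexHull_min (t := {x | μ ≤ m x}) h (convex_halfSpace_ge m.isLinear μ) ha

/-- If `m` is bounded below by `μ` on a finite set `p`, then every point of its convex hull at which
`m` takes the value `μ` lies in the convex hull of the points of `p` at which it does. -/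
theorem LinearMap.mem_convexHull_filter_of_eq {E : Type*} [AddCommGroup E] [Module ℚ E]
    {p : Finset E} (m : E →ₗ[ℚ] ℚ) {μ : ℚ} (h : ∀ x ∈ p, μ ≤ m x) {a : E}
    (ha : a ∈ convexHull ℚ (p : Set E)) (hma : m a = μ) :
    a ∈ convexHull ℚ ((p.filter fun x => m x = μ : Finset E) : Set E) := by
  obtain ⟨w, hw₀, hw₁, hwa⟩ := Finset.mem_convexHull'.1 ha
  have hsum : ∑ x ∈ p, w x * (m x - μ) = 0 := by
    have : ∑ x ∈ p, w x * m x = μ := by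
      rw [← hma, ← hwa, map_sum]
      simp
    simp only [mul_sub, Finset.sum_sub_distrib, ← Finset.sum_mul, this, hw₁, one_mul, sub_self]
  have hzero : ∀ x ∈ p, w x ≠ 0 → m x = μ := by
    intro x hx hwx
    have := (Finset.sum_eq_zero_iff_of_nonneg fun y hy =>
      mul_nonneg (hw₀ y hy) (sub_nonneg.2 (h y hy))).1 hsum x hx
    exact sub_eq_zero.1 ((mul_eq_zero.1 this).resolve_left hwx)
  refine Finset.mem_convexHull'.2 ⟨w, fun x hx => hw₀ x (Finset.mem_filter.1 hx).1, ?_, ?_⟩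
  · rw [Finset.sum_filter_of_ne hzero, hw₁]
  · rw [Finset.sum_filter_of_ne fun x hx hne => hzero x hx fun h0 => hne (by simp [h0]), hwa]

/-- Let `E` be a finite-dimensional `ℚ`-vector space, `σ` the convex cone generated by a finite
set `s` of vectors, `P` the convex hull of a finite nonempty set `p` (a polytope), and
`C = P + σ`.  If the linear functional `m` is nonnegative on `σ`, then `m` attains its minimum
on `C`, and the face `{v ∈ C | m v minimal}` is again `Q + (σ ∩ ker m)` for some polytope `Q`;
i.e. the face is a `(σ ∩ m^⊥)`-polyhedron. -/
theorem face_of_polyhedron_is_polyhedron {E : Type*} [AddCommGroup E] [Module ℚ E]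
    [FiniteDimensional ℚ E]
    (s : Finset E) (p : Finset E) (hp : p.Nonempty) (m : E →ₗ[ℚ] ℚ)
    (σ : Set E) (hσ : σ = {x | ∃ c : E → ℚ, (∀ v, 0 ≤ c v) ∧ x = ∑ v ∈ s, c v • v})
    (hm : ∀ v ∈ σ, 0 ≤ m v)
    (C : Set E) (hC : C = convexHull ℚ (p : Set E) + σ) :
    (∃ v₀ ∈ C, ∀ v ∈ C, m v₀ ≤ m v) ∧
      ∃ q : Finset E, q.Nonempty ∧
        {v ∈ C | ∀ v' ∈ C, m v ≤ m v'} =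
          convexHull ℚ (q : Set E) + (σ ∩ {v | m v = 0}) := by
  have h0 : (0 : E) ∈ σ := hσ ▸ ⟨0, fun _ => le_rfl, by simp⟩
  obtain ⟨x₀, hx₀, hmin⟩ := p.exists_min_image m hp
  have hxC : x₀ ∈ C := hC ▸ ⟨x₀, subset_convexHull ℚ _ hx₀, 0, h0, add_zero _⟩
  have hle : ∀ v ∈ C, m x₀ ≤ m v := by
    rw [hC]
    rintro _ ⟨a, ha, b, hb, rfl⟩
    rw [map_add]
    exact le_add_of_le_of_nonneg (m.le_of_mem_convexHull hmin ha) (hm b hb)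
  refine ⟨⟨x₀, hxC, hle⟩, p.filter fun x => m x = m x₀,
    ⟨x₀, Finset.mem_filter.2 ⟨hx₀, rfl⟩⟩, Set.Subset.antisymm ?_ ?_⟩
  · rintro v ⟨hv, hvle⟩
    have hvx := hvle x₀ hxC
    rw [hC] at hv
    obtain ⟨a, ha, b, hb, rfl⟩ := hv
    rw [map_add] at hvx
    have ha' := m.le_of_mem_convexHull hmin ha
    have hb' := hm b hb
    exact ⟨a, m.mem_convexHull_filter_of_eq hmin ha (by linarith), b,
      ⟨hb, show m b = 0 by linarith⟩, rfl⟩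
  · rintro _ ⟨a, ha, b, ⟨hb, hmb⟩, rfl⟩
    have hma : m a = m x₀ :=
      convexHull_min (t := {x | m x = m x₀}) (fun x hx => (Finset.mem_filter.1 hx).2)
        (convex_hyperplane m.isLinear _) ha
    refine ⟨hC ▸ ⟨a, convexHull_mono (Finset.coe_subset.2 (Finset.filter_subset _ _)) ha,
      b, hb, rfl⟩, fun v hv => ?_⟩
    have hmb' : m b = 0 := hmb
    rw [map_add, hma, hmb', add_zero]
    exact hle v hv
end

section
/- Let k be a field, let n ≥ 1 be an integer, and let K = k(t, s) be the field of fractions of k[t, s]. Let φ : k[x, y, z] → K be the k-algebra homomorphism determined by φ(x) = sⁿ/t, φ(y) = t(t+1)/sⁿ, φ(z) = s. Then the kernel of φ is the principal ideal generated by x²y − x − zⁿ. Consequently, the subalgebra k[t^{-1}sⁿ, t(t+1)s^{-n}, s] of K is isomorphic to the coordinate ring of the smooth surface W_n = {x²y = x + zⁿ} ⊆ 𝔸³. -/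
open MvPolynomial

namespace Wn

/-- Replacing `t` by `sⁿ/t` keeps the generators of `k(t,s)` algebraically independent. -/
theorem algebraicIndependent_pow_div {k : Type*} [Field k] (n : ℕ)
    (t s : FractionRing (MvPolynomial (Fin 2) k))
    (ht : t = algebraMap (MvPolynomial (Fin 2) k) (FractionRing (MvPolynomial (Fin 2) k)) (X 0))
    (hs : s = algebraMap (MvPolynomial (Fin 2) k) (FractionRing (MvPolynomial (Fin 2) k)) (X 1)) :
    AlgebraicIndependent k ![s ^ n / t, s] := by
  have hs0 : s ≠ 0 := by simp [hs]
  set A := Algebra.adjoin k (Set.range ![s ^ n / t, s])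
  have hmem (y : FractionRing (MvPolynomial (Fin 2) k)) (hy : y ∈ A) : IsAlgebraic A y :=
    isAlgebraic_algebraMap (⟨y, hy⟩ : A)
  have hs' : IsAlgebraic A s := hmem s (Algebra.subset_adjoin ⟨1, rfl⟩)
  have hu' : IsAlgebraic A (s ^ n / t) := hmem _ (Algebra.subset_adjoin ⟨0, rfl⟩)
  have ht' : IsAlgebraic A t := by
    have h : t = s ^ n * (s ^ n / t)⁻¹ := by field_simp
    rw [h]
    exact (hs'.pow n).mul hu'.inv
  have hpoly (p : MvPolynomial (Fin 2) k) :
      IsAlgebraic A (algebraMap _ (FractionRing (MvPolynomial (Fin 2) k)) p) := by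
    induction p using MvPolynomial.induction_on with
    | C a =>
      rw [← MvPolynomial.algebraMap_eq, ← IsScalarTower.algebraMap_apply]
      exact hmem _ (A.algebraMap_mem a)
    | add p q hp hq => simpa only [map_add] using hp.add hq
    | mul_X p i hp =>
      rw [map_mul]
      refine hp.mul ?_
      fin_cases i
      · exact ht ▸ ht'
      · exact hs ▸ hs'
  have : Algebra.IsAlgebraic A (FractionRing (MvPolynomial (Fin 2) k)) := ⟨fun y ↦ by
    obtain ⟨a, b, -, rfl⟩ := IsFractionRing.div_surjective (A := MvPolynomial (Fin 2) k) y
    rw [div_eq_mul_inv]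
    exact (hpoly a).mul (hpoly b).inv⟩
  have hX : AlgebraicIndependent k fun i ↦
      algebraMap (MvPolynomial (Fin 2) k) (FractionRing (MvPolynomial (Fin 2) k)) (X i) :=
    (MvPolynomial.algebraicIndependent_X (Fin 2) k).map'
      (f := IsScalarTower.toAlgHom k _ (FractionRing (MvPolynomial (Fin 2) k)))
      (IsFractionRing.injective _ _)
  exact (Algebra.IsAlgebraic.isTranscendenceBasis_of_lift_le_trdeg_of_finite k _
    hX.lift_cardinalMk_le_trdeg).1

/-- Modulo `x²y - x - zⁿ`, a power of `x` clears `y` from any polynomial. -/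
theorem exists_X_pow_mul_sub_rename_mem {k : Type*} [Field k] (n : ℕ)
    (p : MvPolynomial (Fin 3) k) :
    ∃ (N : ℕ) (q : MvPolynomial (Fin 2) k), X 0 ^ N * p - rename ![0, 2] q ∈
      Ideal.span {(X 0 : MvPolynomial (Fin 3) k) ^ 2 * X 1 - X 0 - X 2 ^ n} := by
  simp only [Ideal.mem_span_singleton']
  induction p using MvPolynomial.induction_on with
  | C a => exact ⟨0, C a, 0, by simp⟩
  | add p p' hp hp' =>
    obtain ⟨N, q, c, h⟩ := hp
    obtain ⟨N', q', c', h'⟩ := hp'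
    refine ⟨N + N', X 0 ^ N' * q + X 0 ^ N * q', X 0 ^ N' * c + X 0 ^ N * c', ?_⟩
    simp only [map_add, map_mul, map_pow, rename_X, Matrix.cons_val_zero]
    linear_combination X 0 ^ N' * h + X 0 ^ N * h'
  | mul_X p i hp =>
    obtain ⟨N, q, c, h⟩ := hp
    match i with
    | 0 =>
      refine ⟨N, q * X 0, c * X 0, ?_⟩
      simp only [map_mul, rename_X, Matrix.cons_val_zero]
      linear_combination X 0 * h
    | 1 =>
      refine ⟨N + 2, q * (X 0 + X 1 ^ n), X 0 ^ 2 * X 1 * c + rename ![0, 2] q, ?_⟩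
      simp only [map_add, map_mul, map_pow, rename_X, Matrix.cons_val_zero, Matrix.cons_val_one]
      linear_combination X 0 ^ 2 * X 1 * h
    | 2 =>
      refine ⟨N, q * X 1, c * X 2, ?_⟩
      simp only [map_mul, rename_X, Matrix.cons_val]
      linear_combination X 2 * h

/-- `x` is a nonzerodivisor modulo `x²y - x - zⁿ`. -/
theorem mem_span_of_X_pow_mul_mem {k : Type*} [Field k] (n N : ℕ) (p : MvPolynomial (Fin 3) k)
    (hp : X 0 ^ N * p ∈
      Ideal.span {(X 0 : MvPolynomial (Fin 3) k) ^ 2 * X 1 - X 0 - X 2 ^ n}) :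
    p ∈ Ideal.span {(X 0 : MvPolynomial (Fin 3) k) ^ 2 * X 1 - X 0 - X 2 ^ n} := by
  have hX : Prime (X 0 : MvPolynomial (Fin 3) k) := X_prime
  induction N with
  | zero => simpa using hp
  | succ N ih =>
    refine ih ?_
    obtain ⟨c, hc⟩ := Ideal.mem_span_singleton'.1 hp
    have hdvd : (X 0 : MvPolynomial (Fin 3) k) ∣ c * X 2 ^ n :=
      ⟨c * (X 0 * X 1 - 1) - X 0 ^ N * p, by linear_combination -hc⟩
    obtain ⟨d, rfl⟩ : X 0 ∣ c := (hX.dvd_or_dvd hdvd).resolve_right fun h ↦ by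
      simpa using X_dvd_X.1 (hX.dvd_of_dvd_pow h)
    refine Ideal.mem_span_singleton'.2 ⟨d, mul_left_cancel₀ hX.ne_zero ?_⟩
    linear_combination hc

end Wn

/-- Let `K = k(t,s)` be the fraction field of `k[t,s]`, `n ≥ 1`, and `φ : k[x,y,z] → K` the
`k`-algebra map with `φ x = sⁿ/t`, `φ y = t(t+1)/sⁿ`, `φ z = s`.  Then `ker φ` is the
principal ideal generated by `x²y - x - zⁿ`; consequently the subalgebra
`k[t⁻¹sⁿ, t(t+1)s⁻ⁿ, s]` of `K` (the image of `φ`) is isomorphic to the coordinate ring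
`k[x,y,z]/(x²y - x - zⁿ)` of the surface `Wₙ = {x²y = x + zⁿ}`. -/
theorem kernel_eq_span_Wn {k : Type*} [Field k] (n : ℕ) (hn : 1 ≤ n)
    (t s : FractionRing (MvPolynomial (Fin 2) k))
    (ht : t = algebraMap (MvPolynomial (Fin 2) k) (FractionRing (MvPolynomial (Fin 2) k)) (X 0))
    (hs : s = algebraMap (MvPolynomial (Fin 2) k) (FractionRing (MvPolynomial (Fin 2) k)) (X 1)) :
    RingHom.ker (aeval ![s ^ n / t, t * (t + 1) / s ^ n, s] :
        MvPolynomial (Fin 3) k →ₐ[k] FractionRing (MvPolynomial (Fin 2) k)) =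
      Ideal.span {(X 0 : MvPolynomial (Fin 3) k) ^ 2 * X 1 - X 0 - X 2 ^ n} ∧
    Nonempty ((MvPolynomial (Fin 3) k ⧸
        Ideal.span {(X 0 : MvPolynomial (Fin 3) k) ^ 2 * X 1 - X 0 - X 2 ^ n}) ≃ₐ[k]
      (aeval ![s ^ n / t, t * (t + 1) / s ^ n, s] :
        MvPolynomial (Fin 3) k →ₐ[k] FractionRing (MvPolynomial (Fin 2) k)).range) := by
  set φ : MvPolynomial (Fin 3) k →ₐ[k] FractionRing (MvPolynomial (Fin 2) k) :=
    aeval ![s ^ n / t, t * (t + 1) / s ^ n, s] with hφ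
  have ht0 : t ≠ 0 := by simp [ht]
  have hs0 : s ≠ 0 := by simp [hs]
  have hker : RingHom.ker φ =
      Ideal.span {(X 0 : MvPolynomial (Fin 3) k) ^ 2 * X 1 - X 0 - X 2 ^ n} := by
    have hle : Ideal.span {(X 0 : MvPolynomial (Fin 3) k) ^ 2 * X 1 - X 0 - X 2 ^ n} ≤
        RingHom.ker φ := by
      rw [Ideal.span_singleton_le_iff_mem, RingHom.mem_ker]
      simp only [hφ, map_sub, map_mul, map_pow, aeval_X, Matrix.cons_val]
      field_simp
      ring
    refine le_antisymm (fun p hp ↦ ?_) hle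
    obtain ⟨N, q, hq⟩ := Wn.exists_X_pow_mul_sub_rename_mem n p
    have hq0 : aeval ![s ^ n / t, s] q = 0 := by
      have h := RingHom.mem_ker.1 (hle hq)
      have hcomp : ![s ^ n / t, t * (t + 1) / s ^ n, s] ∘ ![0, 2] = ![s ^ n / t, s] := by
        ext i
        fin_cases i <;> rfl
      rw [map_sub, map_mul, RingHom.mem_ker.1 hp, mul_zero, zero_sub, neg_eq_zero, hφ,
        aeval_rename, hcomp] at h
      exact h
    rw [(Wn.algebraicIndependent_pow_div n t s ht hs).eq_zero_of_aeval_eq_zero q hq0,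
      map_zero, sub_zero] at hq
    exact Wn.mem_span_of_X_pow_mul_mem n N p hq
  exact ⟨hker, ⟨(Ideal.quotientEquivAlgOfEq k hker.symm).trans
    (Ideal.quotientKerEquivRange φ)⟩⟩
end

section
/- Let k be a field and let K = k(z, a, b) be the rational function field in three variables over k. Let φ : k[u, v, w, t] → K be the k-algebra homomorphism determined by φ(u) = b, φ(v) = (1−z)⁸ a²⁴ / (z²³ b), φ(w) = (1−z) a³ / z³, φ(t) = (1−z)³ a⁸ / z⁸. Then the kernel of φ is the principal ideal generated by u v − w⁸ + t³. Consequently, the image of φ is isomorphic to k[u, v, w, t]/(u v − w⁸ + t³). -/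
open MvPolynomial

/-- Multiplying a polynomial in `u, v, w, t` by a power of `u` makes it congruent, modulo
`uv - w⁸ + t³`, to a polynomial in `u, w, t`. -/
theorem exists_dvd_X_pow_mul_sub_aeval {k : Type*} [Field k] (p : MvPolynomial (Fin 4) k) :
    ∃ (n : ℕ) (q : MvPolynomial (Fin 3) k),
      (X 0 : MvPolynomial (Fin 4) k) * X 1 - X 2 ^ 8 + X 3 ^ 3 ∣
        X 0 ^ n * p - aeval (![X 0, X 2, X 3] : Fin 3 → MvPolynomial (Fin 4) k) q := by
  induction p using MvPolynomial.induction_on with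
  | C c => exact ⟨0, C c, by simp⟩
  | add p₁ p₂ h₁ h₂ =>
    obtain ⟨n₁, q₁, r₁, h₁⟩ := h₁
    obtain ⟨n₂, q₂, r₂, h₂⟩ := h₂
    refine ⟨n₁ + n₂, X 0 ^ n₂ * q₁ + X 0 ^ n₁ * q₂, X 0 ^ n₂ * r₁ + X 0 ^ n₁ * r₂, ?_⟩
    simp only [map_add, map_mul, map_pow, aeval_X, Matrix.cons_val_zero]
    linear_combination X 0 ^ n₂ * h₁ + X 0 ^ n₁ * h₂
  | mul_X p i h =>
    obtain ⟨n, q, r, h⟩ := h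
    fin_cases i
    · refine ⟨n, q * X 0, r * X 0, ?_⟩
      simp only [map_mul, aeval_X, Matrix.cons_val, Fin.zero_eta]
      linear_combination X 0 * h
    · refine ⟨n + 1, q * (X 1 ^ 8 - X 2 ^ 3), X 0 ^ n * p + r * (X 2 ^ 8 - X 3 ^ 3), ?_⟩
      simp only [map_mul, map_sub, map_pow, aeval_X, Matrix.cons_val, Fin.mk_one]
      linear_combination (X 2 ^ 8 - X 3 ^ 3) * h
    · refine ⟨n, q * X 1, r * X 2, ?_⟩
      simp only [map_mul, aeval_X, Matrix.cons_val, Fin.reduceFinMk]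
      linear_combination X 2 * h
    · refine ⟨n, q * X 2, r * X 3, ?_⟩
      simp only [map_mul, aeval_X, Matrix.cons_val, Fin.reduceFinMk]
      linear_combination X 3 * h

/-- If `x₀, x₂, x₃` are algebraically independent and `x₀x₁ = x₂⁸ - x₃³`, then `uv - w⁸ + t³`
generates the ideal of relations between `x₀, x₁, x₂, x₃`. -/
theorem ker_aeval_eq_span_of_algebraicIndependent {k A : Type*} [Field k] [CommRing A]
    [Algebra k A] (x : Fin 4 → A) (hind : AlgebraicIndependent k ![x 0, x 2, x 3])
    (hrel : x 0 * x 1 = x 2 ^ 8 - x 3 ^ 3) :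
    RingHom.ker (aeval x : MvPolynomial (Fin 4) k →ₐ[k] A) =
      Ideal.span {(X 0 : MvPolynomial (Fin 4) k) * X 1 - X 2 ^ 8 + X 3 ^ 3} := by
  set g : MvPolynomial (Fin 4) k := X 0 * X 1 - X 2 ^ 8 + X 3 ^ 3 with hg
  have hgx : aeval x g = 0 := by
    simp only [hg, map_add, map_sub, map_mul, map_pow, aeval_X, hrel]
    ring
  have hX : ¬ X 0 ∣ g := by
    rintro ⟨r, hr⟩
    have h := congrArg (aeval (![0, 0, 1, 0] : Fin 4 → k)) hr
    simp [hg] at h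
  ext p
  rw [RingHom.mem_ker, Ideal.mem_span_singleton]
  refine ⟨fun hp => ?_, ?_⟩
  · obtain ⟨n, q, r, hr⟩ := exists_dvd_X_pow_mul_sub_aeval p
    have hcomp : (aeval x).comp (aeval (![X 0, X 2, X 3] : Fin 3 → MvPolynomial (Fin 4) k)) =
        (aeval ![x 0, x 2, x 3] : MvPolynomial (Fin 3) k →ₐ[k] A) := by
      ext i
      fin_cases i <;> simp
    have hq : q = 0 := by
      apply hind.eq_zero_of_aeval_eq_zero
      have h := congrArg (aeval x) hr
      rw [map_sub, map_mul, map_mul, ← hg, hgx, hp, ← AlgHom.comp_apply, hcomp] at h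
      simpa using h
    rw [hq, map_zero, sub_zero, ← hg] at hr
    obtain ⟨s, rfl⟩ := X_prime.pow_dvd_of_dvd_mul_left n hX (Dvd.intro _ hr)
    refine ⟨s, mul_left_cancel₀ (pow_ne_zero n (X_ne_zero (0 : Fin 4))) ?_⟩
    rw [hr]
    ring
  · rintro ⟨r, rfl⟩
    rw [map_mul, hgx, zero_mul]

/-- If the variables become algebraic over `k[x₁, …, xₙ]`, then `x₁, …, xₙ` are algebraically
independent in the field of rational functions in `n` variables. -/
theorem algebraicIndependent_of_isAlgebraic_X {k ι : Type*} [Field k] [Finite ι]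
    (x : ι → FractionRing (MvPolynomial ι k))
    (h : ∀ i, IsAlgebraic (Algebra.adjoin k (Set.range x))
      (algebraMap (MvPolynomial ι k) (FractionRing (MvPolynomial ι k)) (X i))) :
    AlgebraicIndependent k x := by
  have hpoly (p : MvPolynomial ι k) : IsAlgebraic (Algebra.adjoin k (Set.range x))
      (algebraMap (MvPolynomial ι k) (FractionRing (MvPolynomial ι k)) p) := by
    induction p using MvPolynomial.induction_on with
    | C c =>
      rw [← algebraMap_eq, ← IsScalarTower.algebraMap_apply]
      exact isAlgebraic_algebraMap
        (algebraMap k (Algebra.adjoin k (Set.range x)) c)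
    | add p q hp hq => rw [map_add]; exact hp.add hq
    | mul_X p i hp => rw [map_mul]; exact hp.mul (h i)
  have halg : Algebra.IsAlgebraic (Algebra.adjoin k (Set.range x))
      (FractionRing (MvPolynomial ι k)) := ⟨fun y => by
    obtain ⟨p, q, -, rfl⟩ := IsFractionRing.div_surjective (A := MvPolynomial ι k) y
    rw [div_eq_mul_inv]
    exact (hpoly p).mul (hpoly q).inv⟩
  have := IsLocalization.isAlgebraic (FractionRing (MvPolynomial ι k))
    (nonZeroDivisors (MvPolynomial ι k))
  refine (Algebra.IsAlgebraic.isTranscendenceBasis_of_lift_le_trdeg_of_finite k x ?_).1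
  exact ((IsTranscendenceBasis.mvPolynomial ι k).algebraMap_comp
    (A := FractionRing (MvPolynomial ι k))).lift_cardinalMk_eq_trdeg.le

/-- Let `K = k(z,a,b)` be the fraction field of `k[z,a,b]` and `φ : k[u,v,w,t] → K` the
`k`-algebra map with `φ u = b`, `φ v = (1-z)⁸a²⁴/(z²³b)`, `φ w = (1-z)a³/z³`,
`φ t = (1-z)³a⁸/z⁸`.  Then `ker φ` is the principal ideal generated by `uv - w⁸ + t³`;
consequently the image of `φ` is isomorphic to `k[u,v,w,t]/(uv - w⁸ + t³)`. -/
theorem kernel_eq_span_uv_sub_w8_add_t3 {k : Type*} [Field k]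
    (z a b : FractionRing (MvPolynomial (Fin 3) k))
    (hz : z = algebraMap (MvPolynomial (Fin 3) k) (FractionRing (MvPolynomial (Fin 3) k)) (X 0))
    (ha : a = algebraMap (MvPolynomial (Fin 3) k) (FractionRing (MvPolynomial (Fin 3) k)) (X 1))
    (hb : b = algebraMap (MvPolynomial (Fin 3) k) (FractionRing (MvPolynomial (Fin 3) k)) (X 2)) :
    RingHom.ker (aeval ![b, (1 - z) ^ 8 * a ^ 24 / (z ^ 23 * b),
        (1 - z) * a ^ 3 / z ^ 3, (1 - z) ^ 3 * a ^ 8 / z ^ 8] :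
        MvPolynomial (Fin 4) k →ₐ[k] FractionRing (MvPolynomial (Fin 3) k)) =
      Ideal.span {(X 0 : MvPolynomial (Fin 4) k) * X 1 - X 2 ^ 8 + X 3 ^ 3} ∧
    Nonempty ((MvPolynomial (Fin 4) k ⧸
        Ideal.span {(X 0 : MvPolynomial (Fin 4) k) * X 1 - X 2 ^ 8 + X 3 ^ 3}) ≃ₐ[k]
      (aeval ![b, (1 - z) ^ 8 * a ^ 24 / (z ^ 23 * b),
        (1 - z) * a ^ 3 / z ^ 3, (1 - z) ^ 3 * a ^ 8 / z ^ 8] :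
        MvPolynomial (Fin 4) k →ₐ[k] FractionRing (MvPolynomial (Fin 3) k)).range) := by
  have hinj := IsFractionRing.injective (MvPolynomial (Fin 3) k)
    (FractionRing (MvPolynomial (Fin 3) k))
  have hz0 : z ≠ 0 := hz ▸ (map_ne_zero_iff _ hinj).2 (X_ne_zero _)
  have ha0 : a ≠ 0 := ha ▸ (map_ne_zero_iff _ hinj).2 (X_ne_zero _)
  have hb0 : b ≠ 0 := hb ▸ (map_ne_zero_iff _ hinj).2 (X_ne_zero _)
  have hz1 : 1 - z ≠ 0 := by
    rw [hz, ← map_one (algebraMap (MvPolynomial (Fin 3) k) _), ← map_sub]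
    refine (map_ne_zero_iff _ hinj).2 fun h => ?_
    simpa using congrArg (aeval (0 : Fin 3 → k)) h
  have hind : AlgebraicIndependent k
      ![b, (1 - z) * a ^ 3 / z ^ 3, (1 - z) ^ 3 * a ^ 8 / z ^ 8] := by
    set x := ![b, (1 - z) * a ^ 3 / z ^ 3, (1 - z) ^ 3 * a ^ 8 / z ^ 8] with hx
    have hmem (i : Fin 3) : IsAlgebraic (Algebra.adjoin k (Set.range x)) (x i) :=
      isAlgebraic_algebraMap (⟨x i, Algebra.subset_adjoin ⟨i, rfl⟩⟩ :
        Algebra.adjoin k (Set.range x))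
    have hzx : z = 1 - x 2 ^ 3 * (x 1 ^ 8)⁻¹ := by
      simp only [hx, Matrix.cons_val]
      field_simp
      ring
    have hax : a = z * x 1 ^ 3 * (x 2)⁻¹ := by
      simp only [hx, Matrix.cons_val]
      field_simp
    have hzalg : IsAlgebraic (Algebra.adjoin k (Set.range x)) z := by
      rw [hzx]
      exact isAlgebraic_one.sub (((hmem 2).pow 3).mul ((hmem 1).pow 8).inv)
    refine algebraicIndependent_of_isAlgebraic_X x fun i => ?_
    fin_cases i
    · exact hz ▸ hzalg
    · refine ha ▸ ?_
      rw [hax]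
      exact (hzalg.mul ((hmem 1).pow 3)).mul (hmem 2).inv
    · exact hb ▸ hmem 0
  have hker := ker_aeval_eq_span_of_algebraicIndependent (k := k)
    ![b, (1 - z) ^ 8 * a ^ 24 / (z ^ 23 * b),
      (1 - z) * a ^ 3 / z ^ 3, (1 - z) ^ 3 * a ^ 8 / z ^ 8] hind (by
    simp only [Matrix.cons_val]
    field_simp
    ring)
  exact ⟨hker, ⟨(Ideal.quotientEquivAlgOfEq k hker.symm).trans
    (Ideal.quotientKerEquivRange _)⟩⟩
end
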